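/- The quantity z*_ν := φup_ν(x*_ν) is positive for every ν ≥ 0, and the function ν ↦ z*_ν is strictly monotone decreasing on [0, ∞). -/

import Mathlib

/-- The lower bound for the phase of Bessel derivatives:
`φlo_ν(x) := √(x² − ν²) − ν·arccos(ν/x) + π/4`. -/
noncomputable def phiLo (ν x : ℝ) : ℝ :=
  Real.sqrt (x ^ 2 - ν ^ 2) - ν * Real.arccos (ν / x) + Real.pi / 4

/-- The upper bound for the phase of Bessel derivatives:
`φup_ν(x) := φlo_ν(x) + (9x² − 2ν²)/(24(x² − ν²)^{3/2})`. -/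
noncomputable def phiUp (ν x : ℝ) : ℝ :=
  phiLo ν x + (9 * x ^ 2 - 2 * ν ^ 2) / (24 * Real.sqrt (x ^ 2 - ν ^ 2) ^ 3)

/-- The polynomial `p_ν(x) := 8x⁶ − 3(8ν² + 1)x⁴ + 4ν²(6ν² − 1)x² − 8ν⁶`. -/
noncomputable def pPoly (ν x : ℝ) : ℝ :=
  8 * x ^ 6 - 3 * (8 * ν ^ 2 + 1) * x ^ 4 + 4 * ν ^ 2 * (6 * ν ^ 2 - 1) * x ^ 2 - 8 * ν ^ 6

open Real in
/-- A sharp lower bound for the angle `θ` by a rational expression in its sine and cosine. -/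
theorem sin_mul_cos_rational_lt {θ : ℝ} (h0 : 0 < θ) (hpi : θ < π) :
    sin θ * cos θ * (23 - 2 * cos θ ^ 2) / (9 + 12 * cos θ ^ 2) < θ := by
  have hder : ∀ y, HasDerivAt
      (fun y => y - sin y * cos y * (23 - 2 * cos y ^ 2) / (9 + 12 * cos y ^ 2))
      (48 * (sin y ^ 2) ^ 2 * (6 + cos y ^ 2) / (9 + 12 * cos y ^ 2) ^ 2) y := by
    intro y
    have hD : (9 + 12 * cos y ^ 2) ≠ 0 := by positivity
    have hN := ((hasDerivAt_sin y).mul (hasDerivAt_cos y)).mul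
      ((((hasDerivAt_cos y).pow 2).const_mul 2).const_sub 23)
    have hQ := (((hasDerivAt_cos y).pow 2).const_mul 12).const_add 9
    refine ((hasDerivAt_id y).sub (hN.div hQ hD)).congr_deriv ?_
    simp only [Pi.mul_apply, Pi.pow_apply]
    field_simp
    have hs : sin y ^ 2 = 1 - cos y ^ 2 := sin_sq y
    have hs4 : sin y ^ 4 = (1 - cos y ^ 2) ^ 2 := by rw [← hs]; ring
    push_cast
    ring_nf
    rw [hs4, hs]
    ring
  have hmono : StrictMonoOn
      (fun y => y - sin y * cos y * (23 - 2 * cos y ^ 2) / (9 + 12 * cos y ^ 2))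
      (Set.Icc 0 π) := by
    refine strictMonoOn_of_deriv_pos (convex_Icc 0 π)
      (fun y _ => (hder y).continuousAt.continuousWithinAt) fun y hy => ?_
    rw [interior_Icc] at hy
    have := sin_pos_of_mem_Ioo hy
    rw [(hder y).deriv]
    positivity
  have := hmono ⟨le_rfl, pi_pos.le⟩ ⟨h0.le, hpi.le⟩ h0
  simpa using this

/-- The value of `phiUp ν` at a root `x` of `pPoly ν`, as a function of `θ = arccos (ν / x)`. -/
noncomputable def critPhase (θ : ℝ) : ℝ :=
  Real.sqrt ((3 + 4 * Real.cos θ ^ 2) / 8) * ((Real.sin θ - θ * Real.cos θ) / Real.sin θ ^ 3)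
    + Real.pi / 4
    + (9 - 2 * Real.cos θ ^ 2) / 24 / Real.sqrt ((3 + 4 * Real.cos θ ^ 2) / 8)

open Real in
theorem hasDerivAt_critPhase {θ : ℝ} (hs : sin θ ≠ 0) :
    HasDerivAt critPhase
      ((3 + 14 * cos θ ^ 2 + 4 * cos θ ^ 4)
        / (8 * √((3 + 4 * cos θ ^ 2) / 8) * sin θ ^ 4)
        * (θ - sin θ * cos θ * (23 - 2 * cos θ ^ 2) / (9 + 12 * cos θ ^ 2))) θ := by
  have hq2 : 0 < (3 + 4 * cos θ ^ 2) / 8 := by positivity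
  have hs2 : sin θ ^ 2 = 1 - cos θ ^ 2 := sin_sq θ
  have hq := (((((hasDerivAt_cos θ).pow 2).const_mul 4).const_add 3).div_const 8).sqrt hq2.ne'
  have hA := ((hasDerivAt_sin θ).sub ((hasDerivAt_id θ).mul (hasDerivAt_cos θ))).div
    ((hasDerivAt_sin θ).pow 3) (pow_ne_zero 3 hs)
  have hB := ((((hasDerivAt_cos θ).pow 2).const_mul 2).const_sub 9).div_const 24
  have hq0 := sqrt_pos.2 hq2
  refine (((hq.mul hA).add_const (π / 4)).add (hB.div hq hq0.ne')).congr_deriv ?_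
  simp only [Pi.mul_apply, Pi.pow_apply, Pi.sub_apply, Pi.div_apply, id_eq]
  have hsq : √((3 + 4 * cos θ ^ 2) / 8) ^ 2 = (3 + 4 * cos θ ^ 2) / 8 := sq_sqrt hq2.le
  generalize √((3 + 4 * cos θ ^ 2) / 8) = q at *
  have hD' : (9 + 12 * cos θ ^ 2) = 24 * q ^ 2 := by rw [hsq]; ring
  rw [hD']
  generalize cos θ = c at *
  generalize sin θ = s at *
  field_simp
  push_cast
  rw [hsq]
  linear_combination s ^ 2 * (θ * (3 * (3 + 4 * c ^ 2)) * (6 + 16 * c ^ 2)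
    + s * c * (-24 * (3 + 4 * c ^ 2) + 2 * (48 + 8 * c ^ 2) * (s ^ 2 + 1 - c ^ 2))) * hs2

theorem strictMonoOn_critPhase : StrictMonoOn critPhase (Set.Ioo 0 Real.pi) := by
  have hs : ∀ θ ∈ Set.Ioo 0 Real.pi, 0 < Real.sin θ := fun θ h => Real.sin_pos_of_mem_Ioo h
  refine strictMonoOn_of_deriv_pos (convex_Ioo 0 _)
    (fun θ h => (hasDerivAt_critPhase (hs θ h).ne').continuousAt.continuousWithinAt)
    fun θ h => ?_
  rw [interior_Ioo] at h
  rw [(hasDerivAt_critPhase (hs θ h).ne').deriv]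
  have := hs θ h
  have := sub_pos.2 (sin_mul_cos_rational_lt h.1 h.2)
  positivity

theorem sqrt_sq_sub_sq_eq_mul_sin_arccos {ν x : ℝ} (hν : 0 ≤ ν) (hx : ν < x) :
    Real.sqrt (x ^ 2 - ν ^ 2) = x * Real.sin (Real.arccos (ν / x)) := by
  have hx0 : 0 < x := hν.trans_lt hx
  rw [Real.sin_arccos, ← Real.sqrt_sq hx0.le, ← Real.sqrt_mul (sq_nonneg _), Real.sqrt_sq hx0.le]
  congr 1
  field_simp

theorem arccos_div_mem_Ioo {ν x : ℝ} (hν : 0 ≤ ν) (hx : ν < x) :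
    Real.arccos (ν / x) ∈ Set.Ioo 0 Real.pi := by
  have hx0 : 0 < x := hν.trans_lt hx
  refine ⟨Real.arccos_pos.2 ((div_lt_one hx0).2 hx), ?_⟩
  have : Real.arccos (ν / x) ≤ Real.pi / 2 := Real.arccos_le_pi_div_two.2 (by positivity)
  linarith [Real.pi_pos]

theorem cos_arccos_div {ν x : ℝ} (hν : 0 ≤ ν) (hx : ν < x) :
    Real.cos (Real.arccos (ν / x)) = ν / x := by
  have hx0 : 0 < x := hν.trans_lt hx
  exact Real.cos_arccos (by linarith [div_nonneg hν hx0.le]) ((div_lt_one hx0).2 hx).le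

theorem phiUp_eq_critPhase {ν x : ℝ} (hν : 0 ≤ ν) (hx : ν < x) (hp : pPoly ν x = 0) :
    phiUp ν x = critPhase (Real.arccos (ν / x)) := by
  have hx0 : 0 < x := hν.trans_lt hx
  unfold phiUp phiLo critPhase
  rw [sqrt_sq_sub_sq_eq_mul_sin_arccos hν hx]
  have hs := Real.sin_pos_of_mem_Ioo (arccos_div_mem_Ioo hν hx)
  have hcs := Real.sin_sq (Real.arccos (ν / x))
  have hc := cos_arccos_div hν hx
  generalize Real.arccos (ν / x) = θ at *
  have hνx : ν = x * Real.cos θ := by rw [hc]; field_simp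
  have hq : (3 + 4 * Real.cos θ ^ 2) / 8 = (x * Real.sin θ ^ 3) ^ 2 := by
    have h6 : (x * Real.sin θ ^ 3) ^ 2 = x ^ 2 * (1 - Real.cos θ ^ 2) ^ 3 := by rw [← hcs]; ring
    rw [h6]
    rw [pPoly, hνx] at hp
    apply mul_left_cancel₀ (pow_ne_zero 4 hx0.ne')
    linear_combination (-1 / 8) * hp
  rw [hq, Real.sqrt_sq (by positivity), hνx]
  field_simp

theorem arccos_div_lt_of_lt {ν₁ ν₂ x₁ x₂ : ℝ} (hν₁ : 0 ≤ ν₁) (hν : ν₁ < ν₂)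
    (hx₁ : ν₁ < x₁) (hx₂ : ν₂ < x₂) (hp₁ : pPoly ν₁ x₁ = 0) (hp₂ : pPoly ν₂ x₂ = 0) :
    Real.arccos (ν₂ / x₂) < Real.arccos (ν₁ / x₁) := by
  have key : ∀ {ν x : ℝ}, 0 ≤ ν → ν < x → pPoly ν x = 0 →
      8 * ν ^ 2 * (1 - (ν / x) ^ 2) ^ 3 = (ν / x) ^ 2 * (3 + 4 * (ν / x) ^ 2) := by
    intro ν x h0 hx hp
    have hx0 : 0 < x := h0.trans_lt hx
    rw [pPoly] at hp
    field_simp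
    linear_combination ν ^ 2 * hp
  have hν₂ : 0 ≤ ν₂ := hν₁.trans hν.le
  have hx₁0 : 0 < x₁ := hν₁.trans_lt hx₁
  have hx₂0 : 0 < x₂ := hν₂.trans_lt hx₂
  have hc₁ : 0 ≤ ν₁ / x₁ := by positivity
  have hc₂ : 0 ≤ ν₂ / x₂ := by positivity
  have hc₁' : ν₁ / x₁ < 1 := (div_lt_one hx₁0).2 hx₁
  have hc₂' : ν₂ / x₂ < 1 := (div_lt_one hx₂0).2 hx₂
  have e₁ := key hν₁ hx₁ hp₁
  have e₂ := key hν₂ hx₂ hp₂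
  refine Real.arccos_lt_arccos (by linarith) ?_ hc₂'.le
  by_contra! hle
  generalize ν₁ / x₁ = c₁ at *
  generalize ν₂ / x₂ = c₂ at *
  have h1 : c₂ ^ 2 * (3 + 4 * c₂ ^ 2) ≤ c₁ ^ 2 * (3 + 4 * c₁ ^ 2) := by gcongr
  have hpos : 0 < 1 - c₁ ^ 2 := by nlinarith
  have h2 : (1 - c₁ ^ 2) ^ 3 ≤ (1 - c₂ ^ 2) ^ 3 := by gcongr
  have h3 : 8 * ν₁ ^ 2 * (1 - c₁ ^ 2) ^ 3 < 8 * ν₂ ^ 2 * (1 - c₁ ^ 2) ^ 3 := by gcongr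
  have h4 : 8 * ν₂ ^ 2 * (1 - c₁ ^ 2) ^ 3 ≤ 8 * ν₂ ^ 2 * (1 - c₂ ^ 2) ^ 3 := by gcongr
  linarith

theorem phiUp_pos {ν x : ℝ} (hν : 0 ≤ ν) (hx : ν < x) : 0 < phiUp ν x := by
  have hx0 : 0 < x := hν.trans_lt hx
  unfold phiUp phiLo
  rw [sqrt_sq_sub_sq_eq_mul_sin_arccos hν hx]
  have hc := cos_arccos_div hν hx
  obtain ⟨hθ, hpi⟩ := arccos_div_mem_Ioo hν hx
  have hs := Real.sin_pos_of_pos_of_lt_pi hθ hpi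
  have hle : Real.arccos (ν / x) ≤ Real.pi / 2 := Real.arccos_le_pi_div_two.2 (by positivity)
  generalize Real.arccos (ν / x) = θ at *
  have hνx : ν = x * Real.cos θ := by rw [hc]; field_simp
  have h1 : θ * Real.cos θ ≤ Real.sin θ := by
    rcases hle.lt_or_eq with h | h
    · have hcpos : 0 < Real.cos θ := Real.cos_pos_of_mem_Ioo ⟨by linarith [Real.pi_pos], h⟩
      have := Real.le_tan hθ.le h
      rwa [Real.tan_eq_sin_div_cos, le_div_iff₀ hcpos] at this
    · simp [h]
  have h2 : 0 ≤ x * Real.sin θ - ν * θ := by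
    have := mul_le_mul_of_nonneg_left h1 hx0.le
    rw [hνx]; linarith
  have h3 : 0 < 9 * x ^ 2 - 2 * ν ^ 2 := by nlinarith
  have h4 : 0 < (9 * x ^ 2 - 2 * ν ^ 2) / (24 * (x * Real.sin θ) ^ 3) := by positivity
  linarith [Real.pi_pos]

/-- The quantity `z*_ν := φup_ν(x*_ν)`, where `x*_ν` is the unique root of `p_ν` in
`(ν, ∞)`, is positive for every `ν ≥ 0`, and `ν ↦ z*_ν` is strictly monotone decreasing
on `[0, ∞)`. -/
theorem zstar_pos_and_strictAnti (xstar : ℝ → ℝ)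
    (hxstar : ∀ ν, 0 ≤ ν → ν < xstar ν ∧ pPoly ν (xstar ν) = 0 ∧
      ∀ y, ν < y → pPoly ν y = 0 → y = xstar ν) :
    (∀ ν, 0 ≤ ν → 0 < phiUp ν (xstar ν)) ∧
      StrictAntiOn (fun ν => phiUp ν (xstar ν)) (Set.Ici 0) := by
  refine ⟨fun ν hν => phiUp_pos hν (hxstar ν hν).1, fun ν₁ h₁ ν₂ h₂ hlt => ?_⟩
  obtain ⟨hx₁, hp₁, -⟩ := hxstar ν₁ h₁
  obtain ⟨hx₂, hp₂, -⟩ := hxstar ν₂ h₂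
  change phiUp ν₂ (xstar ν₂) < phiUp ν₁ (xstar ν₁)
  rw [phiUp_eq_critPhase h₁ hx₁ hp₁, phiUp_eq_critPhase h₂ hx₂ hp₂]
  exact strictMonoOn_critPhase (arccos_div_mem_Ioo h₂ hx₂) (arccos_div_mem_Ioo h₁ hx₁)
    (arccos_div_lt_of_lt h₁ hlt hx₁ hx₂ hp₁ hp₂)
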